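/- Let λ > 4, for each n ∈ ℕ let g_n : [0,1] → ℝ be the staircase function g_n(x) := i/n for (i−1)/n ≤ x < i/n, i = 1,…,n, and let u_n be the unique minimizer of ROF_{λ,g_n} over BV(]0,1[). Then for all n sufficiently large there exist 0 < a_n < b_n < 1 with a_n → 1/√λ and b_n → 1 − 1/√λ as n → ∞, such that u_n = g_n on [a_n, b_n] and u_n is constant on each of the intervals [0, a_n) and (b_n, 1]. -/

import Mathlib

open MeasureTheory Filter Set Topology
open scoped ENNReal NNReal

noncomputable section

/-- `Ψ₁(t) = ∫_{-∞}^t ψ(s) ds`. -/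
def Psi1 (ψ : ℝ → ℝ) (t : ℝ) : ℝ := ∫ s in Set.Iic t, ψ s

/-- `Ψ_p(t) = ∫_{-∞}^t ψ(s)^{1/p} ds`. -/
def Psip (ψ : ℝ → ℝ) (p t : ℝ) : ℝ := ∫ s in Set.Iic t, ψ s ^ (1 / p)

/-- The natural extension of `Ψ₁` to the extended reals:
`Ψ₁(-∞) = 0`, `Ψ₁(+∞) = ∫_ℝ ψ`. -/
def Psi1E (ψ : ℝ → ℝ) (t : EReal) : ℝ :=
  if t = ⊤ then ∫ s, ψ s else if t = ⊥ then 0 else Psi1 ψ t.toReal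

/-- Standing assumptions on `ψ` in the case `p = 1`: a bounded, everywhere positive
Borel function, integrable on `ℝ`, whose infimum on every compact set is positive. -/
structure PsiHyp (ψ : ℝ → ℝ) : Prop where
  measurable : Measurable ψ
  pos : ∀ t, 0 < ψ t
  bounded : ∃ C, ∀ t, ψ t ≤ C
  integrable : MeasureTheory.Integrable ψ
  inf_pos : ∀ K : Set ℝ, IsCompact K → ∃ δ > 0, ∀ t ∈ K, δ ≤ ψ t

/-- Standing assumptions on `ψ` in the case `p > 1`: as in `PsiHyp` but with
`ψ^{1/p}` integrable on `ℝ`. -/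
structure PsiHypP (ψ : ℝ → ℝ) (p : ℝ) : Prop where
  measurable : Measurable ψ
  pos : ∀ t, 0 < ψ t
  bounded : ∃ C, ∀ t, ψ t ≤ C
  integrable : MeasureTheory.Integrable fun t => ψ t ^ (1 / p)
  inf_pos : ∀ K : Set ℝ, IsCompact K → ∃ δ > 0, ∀ t ∈ K, δ ≤ ψ t

/-- `(μp, μn)` is the Jordan decomposition of the distributional derivative of
`u ∈ L¹(]a,b[)`; the existence of such a pair encodes `u ∈ BV(]a,b[)`,
and `μp + μn` is the total variation measure `|u'|`. -/
def IsDerivMeasures (a b : ℝ) (u : ℝ → ℝ) (μp μn : Measure ℝ) : Prop :=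
  MeasureTheory.IntegrableOn u (Set.Ioo a b) ∧
  IsFiniteMeasure μp ∧ IsFiniteMeasure μn ∧ μp ⟂ₘ μn ∧
  μp (Set.Ioo a b)ᶜ = 0 ∧ μn (Set.Ioo a b)ᶜ = 0 ∧
  ∀ φ : ℝ → ℝ, ContDiff ℝ 1 φ → tsupport φ ⊆ Set.Ioo a b →
    ∫ x in Set.Ioo a b, u x * deriv φ x = (∫ x, φ x ∂μn) - ∫ x, φ x ∂μp

/-- The density `(u')^a` of the absolutely continuous part of the derivative whose
Jordan decomposition is `(μp, μn)`. -/
def uaD (μp μn : Measure ℝ) (x : ℝ) : ℝ :=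
  (μp.rnDeriv MeasureTheory.volume x).toReal - (μn.rnDeriv MeasureTheory.volume x).toReal

/-- Left approximate limit `u₋(y) = lim_{ε→0⁺} ε⁻¹ ∫_{y-ε}^y u`. -/
def leftApproxLim (u : ℝ → ℝ) (y : ℝ) : ℝ :=
  limUnder (𝓝[>] (0 : ℝ)) fun ε => (∫ x in Set.Ioo (y - ε) y, u x) / ε

/-- Right approximate limit `u₊(y) = lim_{ε→0⁺} ε⁻¹ ∫_y^{y+ε} u`. -/
def rightApproxLim (u : ℝ → ℝ) (y : ℝ) : ℝ :=
  limUnder (𝓝[>] (0 : ℝ)) fun ε => (∫ x in Set.Ioo y (y + ε), u x) / ε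

/-- Left approximate limit computed in the extended reals (may be `±∞`). -/
def leftApproxLimE (u : ℝ → ℝ) (y : ℝ) : EReal :=
  limUnder (𝓝[>] (0 : ℝ)) fun ε => (((∫ x in Set.Ioo (y - ε) y, u x) / ε : ℝ) : EReal)

/-- Right approximate limit computed in the extended reals (may be `±∞`). -/
def rightApproxLimE (u : ℝ → ℝ) (y : ℝ) : EReal :=
  limUnder (𝓝[>] (0 : ℝ)) fun ε => (((∫ x in Set.Ioo y (y + ε), u x) / ε : ℝ) : EReal)

/-- The jump set `S_u` of `u` in `]a,b[`. -/
def jumpSet (a b : ℝ) (u : ℝ → ℝ) : Set ℝ :=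
  {y | y ∈ Set.Ioo a b ∧ leftApproxLim u y ≠ rightApproxLim u y}

/-- `ν_u = sign(u₊ - u₋)`. -/
def jumpSign (u : ℝ → ℝ) (y : ℝ) : ℝ :=
  Real.sign (rightApproxLim u y - leftApproxLim u y)

/-- `Z⁺[w] = {x ∈ ]a,b[ : lim_{ε→0⁺} (2ε)⁻¹∫_{x-ε}^{x+ε} w = +∞}`. -/
def ZPlus (a b : ℝ) (w : ℝ → ℝ) : Set ℝ :=
  {x | x ∈ Set.Ioo a b ∧
    Tendsto (fun ε => (∫ t in Set.Ioo (x - ε) (x + ε), w t) / (2 * ε)) (𝓝[>] (0 : ℝ)) atTop}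

/-- `Z⁻[w] = {x ∈ ]a,b[ : lim_{ε→0⁺} (2ε)⁻¹∫_{x-ε}^{x+ε} w = -∞}`. -/
def ZMinus (a b : ℝ) (w : ℝ → ℝ) : Set ℝ :=
  {x | x ∈ Set.Ioo a b ∧
    Tendsto (fun ε => (∫ t in Set.Ioo (x - ε) (x + ε), w t) / (2 * ε)) (𝓝[>] (0 : ℝ)) atBot}

/-- The positive part `((u')^c)⁺` of the Cantor part of the derivative of `u`:
the singular part of `μp` with the atoms on the jump set removed. -/
def cantorPos (a b : ℝ) (u : ℝ → ℝ) (μp : Measure ℝ) : Measure ℝ :=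
  (μp.singularPart MeasureTheory.volume).restrict (jumpSet a b u)ᶜ

/-- The negative part `((u')^c)⁻` of the Cantor part of the derivative of `u`. -/
def cantorNeg (a b : ℝ) (u : ℝ → ℝ) (μn : Measure ℝ) : Measure ℝ :=
  (μn.singularPart MeasureTheory.volume).restrict (jumpSet a b u)ᶜ

/-- `u ∈ X¹_ψ(]a,b[)`, with derivative data `(μp, μn)`:  `u ∈ BV(]a,b[)`,
`Ψ₁∘(u')^a ∈ BV(]a,b[)`, and `((u')^c)^±` is concentrated on `Z^±[(u')^a]`. -/
def MemX1 (ψ : ℝ → ℝ) (a b : ℝ) (u : ℝ → ℝ) (μp μn : Measure ℝ) : Prop :=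
  IsDerivMeasures a b u μp μn ∧
  (∃ νp νn : Measure ℝ, IsDerivMeasures a b (fun x => Psi1 ψ (uaD μp μn x)) νp νn) ∧
  cantorPos a b u μp (ZPlus a b (uaD μp μn))ᶜ = 0 ∧
  cantorNeg a b u μn (ZMinus a b (uaD μp μn))ᶜ = 0

/-- `f ∈ W^{1,p}(]a,b[)`: `f` has an absolutely continuous representative whose
pointwise a.e. derivative lies in `L^p(]a,b[)`. -/
def MemW1pOn (p a b : ℝ) (f : ℝ → ℝ) : Prop :=
  ∃ g w : ℝ → ℝ,
    (∀ᵐ x ∂(MeasureTheory.volume.restrict (Set.Ioo a b)), g x = f x) ∧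
    MeasureTheory.IntegrableOn w (Set.Ioo a b) ∧
    MeasureTheory.IntegrableOn (fun x => |w x| ^ p) (Set.Ioo a b) ∧
    ∀ x ∈ Set.Ioo a b, ∀ y ∈ Set.Ioo a b, g y - g x = ∫ t in x..y, w t

/-- `u ∈ X^p_ψ(]a,b[)`, with derivative data `(μp, μn)`:  `u ∈ BV(]a,b[)`,
`Ψ_p∘(u')^a ∈ W^{1,p}(]a,b[)`, and `((u')^s)^±` is concentrated on `Z^±[(u')^a]`. -/
def MemXp (ψ : ℝ → ℝ) (p a b : ℝ) (u : ℝ → ℝ) (μp μn : Measure ℝ) : Prop :=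
  IsDerivMeasures a b u μp μn ∧
  MemW1pOn p a b (fun x => Psip ψ p (uaD μp μn x)) ∧
  (μp.singularPart MeasureTheory.volume) (ZPlus a b (uaD μp μn))ᶜ = 0 ∧
  (μn.singularPart MeasureTheory.volume) (ZMinus a b (uaD μp μn))ᶜ = 0

/-- `u ∈ W^{2,p}(]a,b[)` with first derivative `v` and second derivative `w`. -/
def W2pRep (p a b : ℝ) (u v w : ℝ → ℝ) : Prop :=
  (∀ x ∈ Set.Ioo a b, HasDerivAt u (v x) x) ∧
  (∀ x ∈ Set.Ioo a b, ∀ y ∈ Set.Ioo a b, v y - v x = ∫ t in x..y, w t) ∧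
  MeasureTheory.IntegrableOn u (Set.Ioo a b) ∧
  MeasureTheory.IntegrableOn v (Set.Ioo a b) ∧
  MeasureTheory.IntegrableOn w (Set.Ioo a b) ∧
  MeasureTheory.IntegrableOn (fun x => |w x| ^ p) (Set.Ioo a b)

/-- The functional `F_p(u) = ∫_a^b |u'| + ∫_a^b ψ(u')|u''|^p` if `u ∈ W^{2,p}(]a,b[)`,
`+∞` otherwise (as an infimum over Sobolev representations). -/
def Fp (ψ : ℝ → ℝ) (p a b : ℝ) (u : ℝ → ℝ) : ℝ≥0∞ :=
  ⨅ (v : ℝ → ℝ) (w : ℝ → ℝ) (_ : W2pRep p a b u v w),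
    ENNReal.ofReal ((∫ x in Set.Ioo a b, |v x|) + ∫ x in Set.Ioo a b, ψ (v x) * |w x| ^ p)

/-- Strong `L¹(]a,b[)` convergence of a sequence. -/
def TendstoL1 (a b : ℝ) (U : ℕ → ℝ → ℝ) (u : ℝ → ℝ) : Prop :=
  (∀ k, MeasureTheory.IntegrableOn (U k) (Set.Ioo a b)) ∧
  MeasureTheory.IntegrableOn u (Set.Ioo a b) ∧
  Tendsto (fun k => ∫ x in Set.Ioo a b, |U k x - u x|) atTop (𝓝 0)

/-- The relaxed functional
`F̄_p(u) = inf { liminf_k F_p(u_k) : u_k → u in L¹(]a,b[) }`. -/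
def FpRel (ψ : ℝ → ℝ) (p a b : ℝ) (u : ℝ → ℝ) : ℝ≥0∞ :=
  ⨅ (U : ℕ → ℝ → ℝ) (_ : TendstoL1 a b U u),
    liminf (fun k => Fp ψ p a b (U k)) atTop

/-- `Φ(s, t₁, t₂)` of the relaxation formula (`s` being the sign of the jump). -/
def Phi (ψ : ℝ → ℝ) (s : ℝ) (t₁ t₂ : EReal) : ℝ :=
  if 0 < s then ((∫ t, ψ t) - Psi1E ψ t₁) + ((∫ t, ψ t) - Psi1E ψ t₂)
  else Psi1E ψ t₁ + Psi1E ψ t₂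

/-- `Φ̂(s, t₁, t₂)` of Remark 2.5. -/
def PhiHat (ψ : ℝ → ℝ) (s : ℝ) (t₁ t₂ : EReal) : ℝ :=
  if 0 < s then (∫ t, ψ t) - Psi1E ψ (max t₁ t₂)
  else Psi1E ψ (min t₁ t₂)

/-- `ubar` is a `C¹([a,b])` representative of `u`. -/
def C1Rep (a b : ℝ) (u ubar : ℝ → ℝ) : Prop :=
  (∀ᵐ x ∂(MeasureTheory.volume.restrict (Set.Ioo a b)), ubar x = u x) ∧
  ContDiffOn ℝ 1 ubar (Set.Icc a b)

/-- `u` solves `min { F̄₁(w) + λ ∫_a^b (w - G)² : w ∈ X¹_ψ(]a,b[) }`. -/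
def IsSolution1 (ψ : ℝ → ℝ) (a b lam : ℝ) (G u : ℝ → ℝ) : Prop :=
  (∃ μp μn : Measure ℝ, MemX1 ψ a b u μp μn) ∧
  ∀ w : ℝ → ℝ, (∃ ηp ηn : Measure ℝ, MemX1 ψ a b w ηp ηn) →
    FpRel ψ 1 a b u + ENNReal.ofReal (lam * ∫ x in Set.Ioo a b, (u x - G x) ^ 2) ≤
    FpRel ψ 1 a b w + ENNReal.ofReal (lam * ∫ x in Set.Ioo a b, (w x - G x) ^ 2)

/-- `u` solves `min { F̄_p(w) + λ ∫_a^b |w - G|² : w ∈ X^p_ψ(]a,b[) }`. -/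
def IsSolutionP (ψ : ℝ → ℝ) (p a b lam : ℝ) (G u : ℝ → ℝ) : Prop :=
  (∃ μp μn : Measure ℝ, MemXp ψ p a b u μp μn) ∧
  ∀ w : ℝ → ℝ, (∃ ηp ηn : Measure ℝ, MemXp ψ p a b w ηp ηn) →
    FpRel ψ p a b u + ENNReal.ofReal (lam * ∫ x in Set.Ioo a b, (u x - G x) ^ 2) ≤
    FpRel ψ p a b w + ENNReal.ofReal (lam * ∫ x in Set.Ioo a b, (w x - G x) ^ 2)

/-- The Rudin–Osher–Fatemi energy `|w'|(]a,b[) + λ∫_a^b (w-g)²`, where `(ηp, ηn)`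
is the Jordan decomposition of the derivative of `w`. -/
def ROFenergy (a b lam : ℝ) (g w : ℝ → ℝ) (ηp ηn : Measure ℝ) : ℝ≥0∞ :=
  (ηp + ηn) (Set.Ioo a b) + ENNReal.ofReal (lam * ∫ x in Set.Ioo a b, (w x - g x) ^ 2)

/-- The left-continuous generalized inverse `g^{-1}(c) = inf {x ∈ [a,b] : g(x) ≥ c}`. -/
def gInv (a b : ℝ) (g : ℝ → ℝ) (c : ℝ) : ℝ :=
  sInf {x | x ∈ Set.Icc a b ∧ c ≤ g x}

end

noncomputable section
open MeasureTheory Filter Set Topology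
open scoped ENNReal NNReal

/-- The staircase datum `g_n(x) = i/n` for `(i-1)/n ≤ x < i/n`, `i = 1, …, n`. -/
noncomputable def gStair (n : ℕ) (x : ℝ) : ℝ := ((⌊(n : ℝ) * x⌋ : ℝ) + 1) / n

theorem setIntegral_measureReal_Iic_mul {μ : Measure ℝ} [IsFiniteMeasure μ]
    (hμ : μ (Ioo (0 : ℝ) 1)ᶜ = 0) {h : ℝ → ℝ} (hh : IntegrableOn h (Ioo 0 1)) :
    ∫ x in Ioo (0 : ℝ) 1, μ.real (Iic x) * h x = ∫ t, (∫ x in t..1, h x) ∂μ := by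
  have hT : MeasurableSet {p : ℝ × ℝ | p.2 ≤ p.1} :=
    measurableSet_le measurable_snd measurable_fst
  have hint : Integrable
      (Function.uncurry fun x t : ℝ => {p : ℝ × ℝ | p.2 ≤ p.1}.indicator (fun p => h p.1) (x, t))
      ((volume.restrict (Ioo (0 : ℝ) 1)).prod μ) := by
    have : Integrable (fun p : ℝ × ℝ => h p.1) ((volume.restrict (Ioo (0 : ℝ) 1)).prod μ) :=
      hh.comp_fst μ
    exact this.indicator hT
  have hswap := integral_integral_swap hint
  have hleft : ∀ x : ℝ, ∫ t, {p : ℝ × ℝ | p.2 ≤ p.1}.indicator (fun p => h p.1) (x, t) ∂μ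
      = μ.real (Iic x) * h x := by
    intro x
    have : (fun t => {p : ℝ × ℝ | p.2 ≤ p.1}.indicator (fun p => h p.1) (x, t))
        = (Iic x).indicator fun _ => h x := by
      ext t
      simp [indicator_apply]
    rw [this, integral_indicator measurableSet_Iic, setIntegral_const, smul_eq_mul]
  simp_rw [hleft] at hswap
  rw [hswap]
  refine integral_congr_ae ?_
  have hae : ∀ᵐ t ∂μ, t ∈ Ioo (0 : ℝ) 1 := hμ
  filter_upwards [hae] with t ht
  have : (fun x => {p : ℝ × ℝ | p.2 ≤ p.1}.indicator (fun p => h p.1) (x, t))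
      = (Ici t).indicator h := by
    ext x
    simp [indicator_apply]
  rw [this, integral_indicator measurableSet_Ici, Measure.restrict_restrict measurableSet_Ici,
    intervalIntegral.integral_of_le ht.2.le, integral_Ioc_eq_integral_Ioo,
    ← integral_Ico_eq_integral_Ioo]
  have : Ici t ∩ Ioo 0 1 = Ico t 1 := by
    ext x
    simp only [mem_inter_iff, mem_Ici, mem_Ioo, mem_Ico]
    exact ⟨fun h => ⟨h.1, h.2.2⟩, fun h => ⟨h.1, ht.1.trans_le h.1, h.2⟩⟩
  rw [this]

theorem integrableOn_measureReal_Iic_mul {μ : Measure ℝ} [IsFiniteMeasure μ]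
    {h : ℝ → ℝ} {s : Set ℝ} (hh : IntegrableOn h s) :
    IntegrableOn (fun x => μ.real (Iic x) * h x) s := by
  have hmono : Monotone fun x : ℝ => μ.real (Iic x) := fun x y hxy =>
    measureReal_mono (Iic_subset_Iic.2 hxy)
  refine hh.bdd_mul (c := μ.real univ) hmono.measurable.aestronglyMeasurable ?_
  refine Eventually.of_forall fun x => ?_
  rw [Real.norm_of_nonneg measureReal_nonneg]
  exact measureReal_mono (subset_univ _)

theorem setIntegral_measureReal_Iic_mul_deriv {μ : Measure ℝ} [IsFiniteMeasure μ]
    (hμ : μ (Ioo (0 : ℝ) 1)ᶜ = 0) {φ : ℝ → ℝ} (hφ : ContDiff ℝ 1 φ)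
    (hsupp : tsupport φ ⊆ Ioo 0 1) :
    ∫ x in Ioo (0 : ℝ) 1, μ.real (Iic x) * deriv φ x = - ∫ t, φ t ∂μ := by
  have hc := hφ.continuous_deriv le_rfl
  have h1 : φ 1 = 0 := image_eq_zero_of_notMem_tsupport fun h => by simpa using hsupp h
  rw [setIntegral_measureReal_Iic_mul hμ
    (hc.integrableOn_Icc.mono_set Ioo_subset_Icc_self), ← integral_neg]
  congr with t
  rw [intervalIntegral.integral_deriv_eq_sub
    (fun x _ => (hφ.differentiable one_ne_zero).differentiableAt) (hc.intervalIntegrable _ _), h1,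
    zero_sub]

theorem integral_deriv_of_tsupport_subset {φ : ℝ → ℝ} (hφ : ContDiff ℝ 1 φ)
    (hsupp : tsupport φ ⊆ Ioo 0 1) : ∫ x in Ioo (0 : ℝ) 1, deriv φ x = 0 := by
  have hc := hφ.continuous_deriv le_rfl
  have h1 : φ 1 = 0 := image_eq_zero_of_notMem_tsupport fun h => by simpa using hsupp h
  have h0 : φ 0 = 0 := image_eq_zero_of_notMem_tsupport fun h => by simpa using hsupp h
  rw [← integral_Ioc_eq_integral_Ioo, ← intervalIntegral.integral_of_le zero_le_one,
    intervalIntegral.integral_deriv_eq_sub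
    (fun x _ => (hφ.differentiable one_ne_zero).differentiableAt) (hc.intervalIntegrable _ _), h1,
    h0, sub_zero]

/-- A continuous function with compact support in `]0,1[` and zero mean has a `C¹` primitive
with compact support in `]0,1[`. -/
theorem exists_primitive_tsupport_subset {η : ℝ → ℝ} (hη : Continuous η) {K : Set ℝ}
    (hK : IsCompact K) (hne : K.Nonempty) (hK1 : K ⊆ Ioo 0 1) (hηK : ∀ x ∉ K, η x = 0)
    (hint : ∫ x in Ioo (0 : ℝ) 1, η x = 0) :
    ∃ φ : ℝ → ℝ, ContDiff ℝ 1 φ ∧ tsupport φ ⊆ Ioo 0 1 ∧ deriv φ = η := by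
  obtain ⟨α, hα, hαm⟩ := hK.exists_isLeast hne
  obtain ⟨β, hβ, hβm⟩ := hK.exists_isGreatest hne
  have hd : ∀ x, HasDerivAt (fun y => ∫ t in (0 : ℝ)..y, η t) (η x) x := fun x =>
    intervalIntegral.integral_hasDerivAt_right (hη.intervalIntegrable _ _)
      (hη.stronglyMeasurableAtFilter _ _) hη.continuousAt
  have hder : deriv (fun y => ∫ t in (0 : ℝ)..y, η t) = η := funext fun x => (hd x).deriv
  refine ⟨fun y => ∫ t in (0 : ℝ)..y, η t, ?_, ?_, hder⟩
  · rw [contDiff_one_iff_deriv, hder]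
    exact ⟨fun x => (hd x).differentiableAt, hη⟩
  · have hsub : Icc α β ⊆ Ioo (0 : ℝ) 1 := fun x hx =>
      ⟨(hK1 hα).1.trans_le hx.1, hx.2.trans_lt (hK1 hβ).2⟩
    refine (closure_minimal ?_ isClosed_Icc).trans hsub
    intro x hx
    by_contra hxn
    apply hx
    have hz : ∀ p q : ℝ, (∀ t ∈ uIcc p q, t ∉ K) → ∫ t in p..q, η t = 0 := fun p q hpq => by
      rw [intervalIntegral.integral_congr (g := fun _ => (0 : ℝ)) fun t ht => hηK t (hpq t ht)]
      simp
    rcases lt_or_ge x α with h | h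
    · refine hz _ _ fun t ht htK => ?_
      have := ht.2
      have h1 := hαm htK
      have h2 := (hK1 hα).1
      exact absurd (this.trans_lt (max_lt h2 h)) (not_lt.2 h1)
    · have hxβ : β < x := lt_of_not_ge fun h' => hxn ⟨h, h'⟩
      have h1 : ∫ t in (0 : ℝ)..1, η t = 0 := by
        rw [intervalIntegral.integral_of_le zero_le_one, integral_Ioc_eq_integral_Ioo, hint]
      have h2 : ∫ t in (1 : ℝ)..x, η t = 0 := hz _ _ fun t ht htK =>
        absurd ((lt_min (hK1 hβ).2 hxβ).trans_le ht.1) (not_lt.2 (hβm htK))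
      change ∫ t in (0 : ℝ)..x, η t = 0
      rw [← intervalIntegral.integral_add_adjacent_intervals (hη.intervalIntegrable 0 1)
        (hη.intervalIntegrable 1 x), h1, h2, add_zero]

/-- The du Bois-Reymond lemma on `]0,1[`. -/
theorem ae_eq_const_of_forall_integral_mul_deriv_eq_zero {f : ℝ → ℝ}
    (hf : IntegrableOn f (Ioo 0 1))
    (h : ∀ φ : ℝ → ℝ, ContDiff ℝ 1 φ → tsupport φ ⊆ Ioo 0 1 →
      ∫ x in Ioo (0 : ℝ) 1, f x * deriv φ x = 0) :
    ∃ C, ∀ᵐ x ∂(volume.restrict (Ioo (0 : ℝ) 1)), f x = C := by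
  let b : ContDiffBump (1 / 2 : ℝ) := ⟨1 / 8, 1 / 4, by norm_num, by norm_num⟩
  set ρ : ℝ → ℝ := b.normed volume with hρ
  have hρc : Continuous ρ := b.continuous_normed
  have hρs : tsupport ρ = Metric.closedBall (1 / 2) (1 / 4) := b.tsupport_normed_eq
  have hρsub : tsupport ρ ⊆ Ioo (0 : ℝ) 1 := by
    rw [hρs, Real.closedBall_eq_Icc]
    intro x hx
    constructor <;> norm_num at hx <;> linarith [hx.1, hx.2]
  have hρI : ∫ x in Ioo (0 : ℝ) 1, ρ x = 1 := by
    rw [setIntegral_eq_integral_of_forall_compl_eq_zero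
      fun x hx => image_eq_zero_of_notMem_tsupport fun h => hx (hρsub h)]
    exact b.integral_normed
  have hmulint : ∀ η : ℝ → ℝ, Continuous η → HasCompactSupport η →
      IntegrableOn (fun x => f x * η x) (Ioo 0 1) := fun η hη hηs => by
    obtain ⟨M, hM⟩ := hη.bounded_above_of_compact_support hηs
    exact Integrable.mul_bdd (c := M) hf hη.aestronglyMeasurable (Eventually.of_forall hM)
  have hρcs : HasCompactSupport ρ := b.hasCompactSupport_normed
  refine ⟨∫ x in Ioo (0 : ℝ) 1, f x * ρ x, ?_⟩
  set C := ∫ x in Ioo (0 : ℝ) 1, f x * ρ x with hC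
  have key := isOpen_Ioo.ae_eq_zero_of_integral_contDiff_smul_eq_zero (μ := volume)
    (U := Ioo (0 : ℝ) 1) (f := fun x => f x - C)
    ((hf.sub (integrableOn_const (by simp))).locallyIntegrableOn) ?_
  · rw [ae_restrict_iff' measurableSet_Ioo]
    filter_upwards [key] with x hx hxI
    linarith [hx hxI]
  · intro η hηd hηs hηsub
    have hηc : Continuous η := hηd.continuous
    set m := ∫ x in Ioo (0 : ℝ) 1, η x with hm
    have hηi : IntegrableOn η (Ioo 0 1) := (hηc.integrable_of_hasCompactSupport hηs).integrableOn
    have hρi : IntegrableOn ρ (Ioo 0 1) := (hρc.integrable_of_hasCompactSupport hρcs).integrableOn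
    obtain ⟨φ, hφ, hφs, hφd⟩ := exists_primitive_tsupport_subset (η := fun x => η x - m * ρ x)
      (K := tsupport η ∪ tsupport ρ) (by fun_prop) (hηs.union hρcs)
      ⟨1 / 2, Or.inr (by rw [hρs]; simp)⟩ (union_subset hηsub hρsub)
      (fun x hx => by
        rw [mem_union, not_or] at hx
        simp [image_eq_zero_of_notMem_tsupport hx.1, image_eq_zero_of_notMem_tsupport hx.2])
      (by rw [integral_sub hηi (hρi.const_mul m), integral_const_mul, hρI, ← hm]; ring)
    have h0 := h φ hφ hφs
    rw [hφd] at h0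
    have h1 : ∫ x in Ioo (0 : ℝ) 1, f x * (η x - m * ρ x)
        = (∫ x in Ioo (0 : ℝ) 1, f x * η x) - m * C := by
      rw [hC, ← integral_const_mul, ← integral_sub (hmulint η hηc hηs)
        ((hmulint ρ hρc hρcs).const_mul m)]
      congr with x
      ring
    rw [← setIntegral_eq_integral_of_forall_compl_eq_zero (s := Ioo (0 : ℝ) 1)
      fun x hx => by
        rw [image_eq_zero_of_notMem_tsupport fun h => hx (hηsub h), zero_smul]]
    have h2 : ∫ x in Ioo (0 : ℝ) 1, η x • (f x - C)
        = (∫ x in Ioo (0 : ℝ) 1, f x * η x) - m * C := by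
      rw [hm, ← integral_mul_const, ← integral_sub (hmulint η hηc hηs) (hηi.mul_const C)]
      congr with x
      simp only [smul_eq_mul]
      ring
    rw [h2, ← h1, h0]

theorem IsDerivMeasures.exists_ae_eq {u : ℝ → ℝ} {μp μn : Measure ℝ}
    (hu : IsDerivMeasures 0 1 u μp μn) :
    ∃ C, ∀ᵐ x ∂(volume.restrict (Ioo (0 : ℝ) 1)),
      u x = C + μp.real (Iic x) - μn.real (Iic x) := by
  obtain ⟨hui, _, _, -, hp, hn, hw⟩ := hu
  have hone : IntegrableOn (fun _ => (1 : ℝ)) (Ioo (0 : ℝ) 1) := integrableOn_const (by simp)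
  have hpi : IntegrableOn (fun x => μp.real (Iic x)) (Ioo 0 1) := by
    simpa using integrableOn_measureReal_Iic_mul (μ := μp) hone
  have hni : IntegrableOn (fun x => μn.real (Iic x)) (Ioo 0 1) := by
    simpa using integrableOn_measureReal_Iic_mul (μ := μn) hone
  suffices h : ∀ φ : ℝ → ℝ, ContDiff ℝ 1 φ → tsupport φ ⊆ Ioo 0 1 →
      ∫ x in Ioo (0 : ℝ) 1, (u x - (μp.real (Iic x) - μn.real (Iic x))) * deriv φ x = 0 by
    obtain ⟨C, hC⟩ :=
      ae_eq_const_of_forall_integral_mul_deriv_eq_zero (hui.sub (hpi.sub hni)) h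
    refine ⟨C, hC.mono fun x hx => ?_⟩
    simp only [Pi.sub_apply] at hx
    linarith
  · intro φ hφ hφs
    have hc := hφ.continuous_deriv le_rfl
    have hd : IntegrableOn (deriv φ) (Ioo 0 1) :=
      hc.integrableOn_Icc.mono_set Ioo_subset_Icc_self
    have hcs : HasCompactSupport φ := isCompact_Icc.of_isClosed_subset (isClosed_tsupport φ)
      (hφs.trans Ioo_subset_Icc_self)
    obtain ⟨M, hM⟩ := hc.bounded_above_of_compact_support hcs.deriv
    have hud : IntegrableOn (fun x => u x * deriv φ x) (Ioo 0 1) :=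
      Integrable.mul_bdd (c := M) hui hc.aestronglyMeasurable (Eventually.of_forall hM)
    have h1 := setIntegral_measureReal_Iic_mul_deriv hp hφ hφs
    have h2 := setIntegral_measureReal_Iic_mul_deriv hn hφ hφs
    have hpd := integrableOn_measureReal_Iic_mul (μ := μp) hd
    have hnd := integrableOn_measureReal_Iic_mul (μ := μn) hd
    have : ∀ x, (u x - (μp.real (Iic x) - μn.real (Iic x))) * deriv φ x
        = u x * deriv φ x - (μp.real (Iic x) * deriv φ x - μn.real (Iic x) * deriv φ x) :=
      fun x => by ring
    simp_rw [this]
    have hsub : IntegrableOn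
        (fun x => μp.real (Iic x) * deriv φ x - μn.real (Iic x) * deriv φ x) (Ioo 0 1) :=
      hpd.sub hnd
    rw [integral_sub hud hsub, integral_sub hpd hnd, h1, h2, hw φ hφ hφs]
    ring

theorem isDerivMeasures_of_eq_add_measureReal {w : ℝ → ℝ} {μ : Measure ℝ} [IsFiniteMeasure μ]
    (hμ : μ (Ioo (0 : ℝ) 1)ᶜ = 0) {c : ℝ} (hw : ∀ x, w x = c + μ.real (Iic x)) :
    IsDerivMeasures 0 1 w μ 0 := by
  have hone : IntegrableOn (fun _ => (1 : ℝ)) (Ioo (0 : ℝ) 1) := integrableOn_const (by simp)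
  have hμi : IntegrableOn (fun x => μ.real (Iic x)) (Ioo 0 1) := by
    simpa using integrableOn_measureReal_Iic_mul (μ := μ) hone
  refine ⟨?_, inferInstance, inferInstance, Measure.MutuallySingular.zero_right, hμ, by simp, ?_⟩
  · rw [funext hw]
    exact (integrableOn_const (by simp)).add hμi
  · intro φ hφ hφs
    have hd : IntegrableOn (deriv φ) (Ioo 0 1) :=
      (hφ.continuous_deriv le_rfl).integrableOn_Icc.mono_set Ioo_subset_Icc_self
    simp_rw [hw, add_mul]
    rw [integral_add (hd.const_mul c) (integrableOn_measureReal_Iic_mul hd), integral_const_mul,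
      integral_deriv_of_tsupport_subset hφ hφs, setIntegral_measureReal_Iic_mul_deriv hμ hφ hφs]
    simp

/-- A calibration criterion for minimality: a nondecreasing `w` with derivative `μ` minimizes the
energy if the primitive `t ↦ ∫_t^1 h` of `h = 2λ(w - g)` takes values in `[-1,0]`, vanishes at `0`
and equals `-1` on the support of `μ`. -/
theorem ROFenergy_le_of_calibration {lam M : ℝ} (hlam : 0 ≤ lam) {g w u : ℝ → ℝ}
    (hg : Measurable g) (hgM : ∀ x ∈ Ioo (0 : ℝ) 1, |g x| ≤ M) {μ μp μn : Measure ℝ}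
    [IsFiniteMeasure μ] (hμ : μ (Ioo (0 : ℝ) 1)ᶜ = 0) {c : ℝ} (hw : ∀ x, w x = c + μ.real (Iic x))
    (h0 : ∫ x in (0 : ℝ)..1, 2 * lam * (w x - g x) = 0)
    (h1 : ∀ t ∈ Ioo (0 : ℝ) 1, (∫ x in t..1, 2 * lam * (w x - g x)) ∈ Icc (-1) 0)
    (h2 : ∀ᵐ t ∂μ, ∫ x in t..1, 2 * lam * (w x - g x) = -1)
    (hu : IsDerivMeasures 0 1 u μp μn) :
    ROFenergy 0 1 lam g w μ 0 ≤ ROFenergy 0 1 lam g u μp μn := by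
  obtain ⟨C, hC⟩ := hu.exists_ae_eq
  obtain ⟨hui, _, _, -, hp, hn, -⟩ := hu
  set h : ℝ → ℝ := fun x => 2 * lam * (w x - g x) with hh
  have hfin : ∀ (ν : Measure ℝ) (x : ℝ), IsFiniteMeasure ν → |ν.real (Iic x)| ≤ ν.real univ :=
    fun ν x _ => by
      rw [abs_of_nonneg measureReal_nonneg]
      exact measureReal_mono (subset_univ _)
  have hwM : ∀ x, |w x| ≤ |c| + μ.real univ := fun x => by
    rw [hw]
    exact (abs_add_le _ _).trans (by gcongr; exact hfin μ x inferInstance)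
  have hwm : Measurable w := by
    have hmono : Monotone fun x : ℝ => μ.real (Iic x) := fun x y hxy =>
      measureReal_mono (Iic_subset_Iic.2 hxy)
    rw [funext hw]
    exact hmono.measurable.const_add c
  have huM : ∀ᵐ x ∂(volume.restrict (Ioo (0 : ℝ) 1)),
      |u x| ≤ |C| + μp.real univ + μn.real univ := by
    filter_upwards [hC] with x hx
    rw [hx]
    refine (abs_sub _ _).trans (add_le_add ((abs_add_le _ _).trans ?_) (hfin μn x inferInstance))
    gcongr
    exact hfin μp x inferInstance
  have hbdd : ∀ {f : ℝ → ℝ} {K : ℝ}, AEStronglyMeasurable f (volume.restrict (Ioo (0 : ℝ) 1)) →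
      (∀ᵐ x ∂(volume.restrict (Ioo (0 : ℝ) 1)), |f x| ≤ K) → MemLp f ⊤ (volume.restrict (Ioo 0 1)) :=
    fun hf hK => memLp_top_of_bound hf _ hK
  have hgae : ∀ᵐ x ∂(volume.restrict (Ioo (0 : ℝ) 1)), |g x| ≤ M :=
    (ae_restrict_iff' measurableSet_Ioo).2 (Eventually.of_forall hgM)
  have hgL := hbdd hg.aestronglyMeasurable hgae
  have hwL := hbdd hwm.aestronglyMeasurable (Eventually.of_forall hwM)
  have huL := hbdd hui.aestronglyMeasurable huM
  have hint : ∀ {f k : ℝ → ℝ}, MemLp f ⊤ (volume.restrict (Ioo (0 : ℝ) 1)) →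
      MemLp k ⊤ (volume.restrict (Ioo (0 : ℝ) 1)) →
      IntegrableOn (fun x => f x * k x) (Ioo 0 1) := fun hf hk =>
    (MemLp.mul (r := ⊤) hk hf).integrable le_top
  have hhL : MemLp h ⊤ (volume.restrict (Ioo (0 : ℝ) 1)) := (hwL.sub hgL).const_mul (2 * lam)
  have hhi : IntegrableOn h (Ioo 0 1) := hhL.integrable le_top
  have hh0 : ∫ x in Ioo (0 : ℝ) 1, h x = 0 := by
    rw [← integral_Ioc_eq_integral_Ioo, ← intervalIntegral.integral_of_le zero_le_one, h0]
  have hZae : ∀ {ν : Measure ℝ}, ν (Ioo (0 : ℝ) 1)ᶜ = 0 →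
      ∀ᵐ t ∂ν, (∫ x in t..1, h x) ∈ Icc (-1 : ℝ) 0 := fun hν => by
    have hae : ∀ᵐ t ∂_, t ∈ Ioo (0 : ℝ) 1 := hν
    exact hae.mono h1
  have hwh : ∫ x in Ioo (0 : ℝ) 1, w x * h x = - μ.real univ := by
    simp_rw [hw, add_mul]
    rw [integral_add (hhi.const_mul c) (integrableOn_measureReal_Iic_mul hhi), integral_const_mul,
      hh0, setIntegral_measureReal_Iic_mul hμ hhi, integral_congr_ae h2]
    simp
  have huh : -μp.real univ ≤ ∫ x in Ioo (0 : ℝ) 1, u x * h x := by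
    have e : ∫ x in Ioo (0 : ℝ) 1, u x * h x
        = ∫ x in Ioo (0 : ℝ) 1, (C * h x + μp.real (Iic x) * h x - μn.real (Iic x) * h x) :=
      integral_congr_ae (hC.mono fun x hx => by simp only [hx]; ring)
    have hadd : IntegrableOn (fun x => C * h x + μp.real (Iic x) * h x) (Ioo 0 1) :=
      (hhi.const_mul C).add (integrableOn_measureReal_Iic_mul hhi)
    rw [e, integral_sub hadd (integrableOn_measureReal_Iic_mul hhi),
      integral_add (hhi.const_mul C) (integrableOn_measureReal_Iic_mul hhi), integral_const_mul,
      hh0, setIntegral_measureReal_Iic_mul hp hhi, setIntegral_measureReal_Iic_mul hn hhi]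
    have hn' : ∫ t, (∫ x in t..1, h x) ∂μn ≤ 0 :=
      integral_nonpos_of_ae ((hZae hn).mono fun t ht => ht.2)
    have hp' : |∫ t, (∫ x in t..1, h x) ∂μp| ≤ 1 * μp.real univ :=
      norm_integral_le_of_norm_le_const ((hZae hp).mono fun t ht => by
        rw [Real.norm_eq_abs, abs_le]
        exact ⟨ht.1, ht.2.trans zero_le_one⟩)
    linarith [neg_le_of_abs_le hp']
  have hmain : lam * ∫ x in Ioo (0 : ℝ) 1, (w x - g x) ^ 2 ≤
      (lam * ∫ x in Ioo (0 : ℝ) 1, (u x - g x) ^ 2) + μp.real univ - μ.real univ := by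
    have hwi : IntegrableOn (fun x => lam * (w x - g x) ^ 2) (Ioo 0 1) := by
      simpa only [sq, Pi.sub_apply, IntegrableOn] using
        (hint (hwL.sub hgL) (hwL.sub hgL)).const_mul lam
    have hui' : IntegrableOn (fun x => lam * (u x - g x) ^ 2) (Ioo 0 1) := by
      simpa only [sq, Pi.sub_apply, IntegrableOn] using
        (hint (huL.sub hgL) (huL.sub hgL)).const_mul lam
    have hcross : IntegrableOn (fun x => u x * h x - w x * h x) (Ioo 0 1) :=
      (hint huL hhL).sub (hint hwL hhL)
    have hle : ∫ x in Ioo (0 : ℝ) 1, (lam * (w x - g x) ^ 2 + (u x * h x - w x * h x)) ≤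
        ∫ x in Ioo (0 : ℝ) 1, lam * (u x - g x) ^ 2 := by
      refine integral_mono (hwi.add hcross) hui' fun x => ?_
      simp only [hh]
      nlinarith [mul_nonneg hlam (sq_nonneg (u x - w x))]
    rw [integral_add hwi hcross, integral_sub (hint huL hhL) (hint hwL hhL),
      integral_const_mul, integral_const_mul, hwh] at hle
    linarith
  have hI : ∀ f : ℝ → ℝ, 0 ≤ lam * ∫ x in Ioo (0 : ℝ) 1, (f x) ^ 2 := fun f =>
    mul_nonneg hlam (integral_nonneg fun x => sq_nonneg _)
  have hμu : μ (Ioo 0 1) = ENNReal.ofReal (μ.real univ) := by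
    rw [ofReal_measureReal, ← measure_add_measure_compl measurableSet_Ioo, hμ, add_zero]
  have hpu : μp (Ioo 0 1) = ENNReal.ofReal (μp.real univ) := by
    rw [ofReal_measureReal, ← measure_add_measure_compl measurableSet_Ioo, hp, add_zero]
  calc ROFenergy 0 1 lam g w μ 0
      = ENNReal.ofReal (μ.real univ + lam * ∫ x in Ioo (0 : ℝ) 1, (w x - g x) ^ 2) := by
        rw [ROFenergy, add_zero, hμu, ← ENNReal.ofReal_add measureReal_nonneg (hI fun x => _)]
    _ ≤ ENNReal.ofReal (μp.real univ + lam * ∫ x in Ioo (0 : ℝ) 1, (u x - g x) ^ 2) :=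
        ENNReal.ofReal_le_ofReal (by linarith)
    _ = μp (Ioo 0 1) + ENNReal.ofReal (lam * ∫ x in Ioo (0 : ℝ) 1, (u x - g x) ^ 2) := by
        rw [hpu, ENNReal.ofReal_add measureReal_nonneg (hI fun x => _)]
    _ ≤ ROFenergy 0 1 lam g u μp μn := by
        rw [ROFenergy, Measure.add_apply]
        gcongr
        exact le_self_add

theorem intervalIntegral_nonneg_of_Ioo {h : ℝ → ℝ} {p q : ℝ} (hpq : p ≤ q)
    (hh : ∀ x ∈ Ioo p q, 0 ≤ h x) : 0 ≤ ∫ x in p..q, h x := by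
  rw [intervalIntegral.integral_of_le hpq, integral_Ioc_eq_integral_Ioo]
  exact setIntegral_nonneg measurableSet_Ioo hh

theorem intervalIntegral_nonpos_of_Ioo {h : ℝ → ℝ} {p q : ℝ} (hpq : p ≤ q)
    (hh : ∀ x ∈ Ioo p q, h x ≤ 0) : ∫ x in p..q, h x ≤ 0 := by
  rw [intervalIntegral.integral_of_le hpq, integral_Ioc_eq_integral_Ioo]
  exact setIntegral_nonpos measurableSet_Ioo hh

theorem intervalIntegral_congr_of_Ioo {f h : ℝ → ℝ} {p q : ℝ} (hpq : p ≤ q)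
    (hh : ∀ x ∈ Ioo p q, f x = h x) : ∫ x in p..q, f x = ∫ x in p..q, h x := by
  simp only [intervalIntegral.integral_of_le hpq, integral_Ioc_eq_integral_Ioo]
  exact setIntegral_congr_fun measurableSet_Ioo hh

/-- Bounds on the primitive of a function which is nonnegative, zero and nonpositive on three
consecutive intervals. -/
theorem primitive_bounds {h : ℝ → ℝ} {a b : ℝ} (hab : a ≤ b) (hi : ∀ p q, IntervalIntegrable h volume p q) (hl : ∀ x < a, 0 ≤ h x)
    (hm : ∀ x ∈ Ico a b, h x = 0) (hr : ∀ x, b ≤ x → h x ≤ 0)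
    (hIl : ∫ x in 0..a, h x = 1) (hIr : ∫ x in b..1, h x = -1) :
    (∫ x in 0..1, h x = 0) ∧ (∀ t ∈ Ioo (0 : ℝ) 1, (∫ x in t..1, h x) ∈ Icc (-1 : ℝ) 0) ∧
      ∀ t ∈ Icc a b, ∫ x in t..1, h x = -1 := by
  have hadd : ∀ p q r, (∫ x in p..q, h x) + ∫ x in q..r, h x = ∫ x in p..r, h x := fun p q r =>
    intervalIntegral.integral_add_adjacent_intervals (hi p q) (hi q r)
  have hmid : ∀ t ∈ Icc a b, ∫ x in t..1, h x = -1 := fun t ht => by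
    have : ∫ x in t..b, h x = 0 :=
      (intervalIntegral_congr_of_Ioo ht.2 fun x hx => hm x ⟨ht.1.trans hx.1.le, hx.2⟩).trans
        intervalIntegral.integral_zero
    rw [← hadd t b 1, this, hIr, zero_add]
  refine ⟨?_, fun t ht => ?_, hmid⟩
  · rw [← hadd 0 a 1, hIl, hmid a ⟨le_rfl, hab⟩, add_neg_cancel]
  · rcases le_total t a with hta | hta
    · have h1 : 0 ≤ ∫ x in 0..t, h x :=
        intervalIntegral_nonneg_of_Ioo ht.1.le fun x hx => hl x (hx.2.trans_le hta)
      have h2 : 0 ≤ ∫ x in t..a, h x := intervalIntegral_nonneg_of_Ioo hta fun x hx => hl x hx.2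
      have h3 := hadd 0 t a
      have h4 := hadd t a 1
      have h5 := hmid a ⟨le_rfl, hab⟩
      constructor <;> linarith
    · rcases le_total t b with htb | htb
      · rw [hmid t ⟨hta, htb⟩]
        simp
      · have h1 : ∫ x in b..t, h x ≤ 0 :=
          intervalIntegral_nonpos_of_Ioo htb fun x hx => hr x hx.1.le
        have h2 : ∫ x in t..1, h x ≤ 0 :=
          intervalIntegral_nonpos_of_Ioo ht.2.le fun x hx => hr x (htb.trans hx.1.le)
        have h3 := hadd b t 1
        constructor <;> linarith

theorem gStair_monotone (n : ℕ) : Monotone (gStair n) := fun x y hxy => by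
  unfold gStair
  gcongr

theorem gStair_rightContinuous (n : ℕ) (x : ℝ) : ContinuousWithinAt (gStair n) (Ici x) x := by
  have h1 : Tendsto (fun y : ℝ => (n : ℝ) * y) (𝓝[≥] x) (𝓝[≥] ((n : ℝ) * x)) := by
    refine tendsto_nhdsWithin_iff.2 ⟨(by fun_prop : Continuous fun y : ℝ => (n : ℝ) * y).continuousAt
      |>.tendsto.mono_left nhdsWithin_le_nhds, ?_⟩
    filter_upwards [self_mem_nhdsWithin] with y hy
    exact mul_le_mul_of_nonneg_left (mem_Ici.1 hy) (Nat.cast_nonneg n)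
  have h2 := (tendsto_floor_right_pure_floor ((n : ℝ) * x)).comp h1
  rw [tendsto_pure] at h2
  refine tendsto_const_nhds.congr' (h2.mono fun y hy => ?_)
  simp only [Function.comp_apply] at hy
  simp only [gStair, hy]

theorem gStair_le_of_lt {n : ℕ} (hn : 0 < n) {j : ℕ} {x : ℝ} (hx : x < j / n) :
    gStair n x ≤ j / n := by
  have hn' : (0 : ℝ) < n := Nat.cast_pos.2 hn
  have : (⌊(n : ℝ) * x⌋ : ℤ) < (j : ℤ) := by
    rw [Int.floor_lt]
    rw [lt_div_iff₀ hn'] at hx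
    push_cast
    linarith
  have h2 : ((⌊(n : ℝ) * x⌋ : ℤ) : ℝ) + 1 ≤ j := by exact_mod_cast this
  unfold gStair
  gcongr

theorem le_gStair_of_le {n : ℕ} (hn : 0 < n) {j : ℕ} {x : ℝ} (hx : j / n ≤ x) :
    ((j : ℝ) + 1) / n ≤ gStair n x := by
  have hn' : (0 : ℝ) < n := Nat.cast_pos.2 hn
  have : (j : ℤ) ≤ ⌊(n : ℝ) * x⌋ := by
    rw [Int.le_floor]
    rw [div_le_iff₀ hn'] at hx
    push_cast
    linarith
  have h2 : (j : ℝ) ≤ ((⌊(n : ℝ) * x⌋ : ℤ) : ℝ) := by exact_mod_cast this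
  unfold gStair
  gcongr

theorem integral_gStair {n : ℕ} (hn : 0 < n) (j : ℕ) :
    ∫ x in (0 : ℝ)..(j / n), gStair n x = j * (j + 1) / (2 * n ^ 2) := by
  have hn' : (0 : ℝ) < n := Nat.cast_pos.2 hn
  induction j with
  | zero => simp
  | succ j ih =>
    have hle : (j : ℝ) / n ≤ ((j + 1 : ℕ) : ℝ) / n := by
      gcongr
      exact Nat.le_succ j
    rw [← intervalIntegral.integral_add_adjacent_intervals
      ((gStair_monotone n).intervalIntegrable (a := 0) (b := j / n))
      (gStair_monotone n).intervalIntegrable, ih,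
      intervalIntegral_congr_of_Ioo hle (h := fun _ => ((j : ℝ) + 1) / n) fun x hx =>
        le_antisymm ((gStair_le_of_lt hn hx.2).trans_eq (by push_cast; rfl))
          (le_gStair_of_le hn hx.1.le), intervalIntegral.integral_const, smul_eq_mul]
    push_cast
    field_simp
    ring

theorem exists_nat_mul_pred_le_le_mul_succ {s : ℝ} (hs : 0 ≤ s) :
    ∃ k : ℕ, 0 < k ∧ (k : ℝ) * (k - 1) ≤ s ∧ s ≤ k * (k + 1) := by
  set q := √(1 / 4 + s) with hq
  have hq2 : q ^ 2 = 1 / 4 + s := Real.sq_sqrt (by positivity)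
  have hq0 : 1 / 2 ≤ q := Real.le_sqrt_of_sq_le (by linarith)
  have h1 : (⌊1 / 2 + q⌋₊ : ℝ) ≤ 1 / 2 + q := Nat.floor_le (by linarith)
  have h2 : 1 / 2 + q < ⌊1 / 2 + q⌋₊ + 1 := Nat.lt_floor_add_one _
  have h3 : 1 ≤ ⌊1 / 2 + q⌋₊ := Nat.le_floor (by push_cast; linarith)
  have h4 : (1 : ℝ) ≤ ⌊1 / 2 + q⌋₊ := by exact_mod_cast h3
  exact ⟨⌊1 / 2 + q⌋₊, h3, by nlinarith, by nlinarith⟩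

/-- The explicit minimizer: the truncation of the staircase to a suitable interval `[c, d]`. -/
theorem exists_gStair_minimizer {lam : ℝ} (hlam : 0 < lam) {n k : ℕ} (hk : 0 < k)
    (hkn : 2 * k < n) (hk1 : (k : ℝ) * (k - 1) ≤ n ^ 2 / lam)
    (hk2 : (n : ℝ) ^ 2 / lam ≤ k * (k + 1)) :
    ∃ (w : ℝ → ℝ) (μ : Measure ℝ) (c d : ℝ), IsDerivMeasures 0 1 w μ 0 ∧
      (∀ (u : ℝ → ℝ) (μp μn : Measure ℝ), IsDerivMeasures 0 1 u μp μn →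
        ROFenergy 0 1 lam (gStair n) w μ 0 ≤ ROFenergy 0 1 lam (gStair n) u μp μn) ∧
      (∀ x < (k : ℝ) / n, w x = c) ∧
      (∀ x ∈ Ico ((k : ℝ) / n) (1 - k / n), w x = gStair n x) ∧
      ∀ x, (1 : ℝ) - k / n ≤ x → w x = d := by
  have hn : 0 < n := by omega
  have hn' : (0 : ℝ) < n := Nat.cast_pos.2 hn
  have hk' : (0 : ℝ) < k := Nat.cast_pos.2 hk
  have hkn' : 2 * (k : ℝ) + 1 ≤ n := by exact_mod_cast hkn
  obtain ⟨m, rfl⟩ : ∃ m, n = m + k := ⟨n - k, by omega⟩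
  set n := m + k with hnm
  have hmr : (m : ℝ) = n - k := by rw [hnm]; push_cast; ring
  have hb : (1 : ℝ) - k / n = m / n := by rw [hmr]; field_simp
  rw [hb]
  set c : ℝ := n / (2 * lam * k) + (k + 1) / (2 * n) with hc
  set d : ℝ := 1 + 1 / n - c with hd
  have hck : (k : ℝ) / n ≤ c := by
    rw [le_div_iff₀ hlam] at hk1
    rw [hc, div_add_div _ _ (by positivity) (by positivity), div_le_div_iff₀ hn' (by positivity)]
    nlinarith [mul_le_mul_of_nonneg_right hk1 hn'.le]
  have hck' : c ≤ (k + 1) / n := by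
    rw [div_le_iff₀ hlam] at hk2
    rw [hc, div_add_div _ _ (by positivity) (by positivity), div_le_div_iff₀ (by positivity) hn']
    nlinarith [mul_le_mul_of_nonneg_right hk2 hn'.le]
  have hdm : (m : ℝ) / n ≤ d := by
    have : (m : ℝ) / n = 1 + 1 / n - (k + 1) / n := by rw [hmr]; field_simp; ring
    rw [this, hd]
    linarith
  have hdm' : d ≤ (m + 1) / n := by
    have : ((m : ℝ) + 1) / n = 1 + 1 / n - k / n := by rw [hmr]; field_simp; ring
    rw [this, hd]
    linarith
  have hkm : ((k : ℝ) + 1) / n ≤ m / n := by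
    gcongr
    rw [hmr]
    linarith
  have hcd : c ≤ d := hck'.trans (hkm.trans hdm)
  have hab : (k : ℝ) / n ≤ m / n := hck.trans (hck'.trans hkm)
  have hm1 : (m : ℝ) / n < 1 := by
    rw [div_lt_one hn', hmr]
    linarith
  let W : StieltjesFunction ℝ :=
    { toFun := fun x => max c (min d (gStair n x))
      mono' := fun x y hxy => max_le_max le_rfl (min_le_min le_rfl (gStair_monotone n hxy))
      right_continuous' := fun x => continuousWithinAt_const.max
        (continuousWithinAt_const.min (gStair_rightContinuous n x)) }
  have hWdef : ∀ x, W x = max c (min d (gStair n x)) := fun x => rfl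
  have hWl : ∀ x < (k : ℝ) / n, W x = c := fun x hx => by
    rw [hWdef, max_eq_left ((min_le_right _ _).trans ((gStair_le_of_lt hn hx).trans hck))]
  have hWm : ∀ x ∈ Ico ((k : ℝ) / n) (m / n), W x = gStair n x := fun x hx => by
    rw [hWdef, min_eq_right ((gStair_le_of_lt hn hx.2).trans hdm),
      max_eq_right (hck'.trans (le_gStair_of_le hn hx.1))]
  have hWr : ∀ x, (m : ℝ) / n ≤ x → W x = d := fun x hx => by
    rw [hWdef, min_eq_left (hdm'.trans (le_gStair_of_le hn hx)), max_eq_right hcd]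
  have hbot : Tendsto W atBot (𝓝 c) := tendsto_const_nhds.congr' <| by
    filter_upwards [eventually_lt_atBot ((k : ℝ) / n)] with x hx
    exact (hWl x hx).symm
  have htop : Tendsto W atTop (𝓝 d) := tendsto_const_nhds.congr' <| by
    filter_upwards [eventually_ge_atTop ((m : ℝ) / n)] with x hx
    exact (hWr x hx).symm
  have hfin : IsFiniteMeasure W.measure := W.isFiniteMeasure hbot htop
  have hWx : ∀ x, W x = c + W.measure.real (Iic x) := fun x => by
    have : c ≤ W x := le_max_left _ _
    rw [measureReal_def, W.measure_Iic hbot, ENNReal.toReal_ofReal (by linarith)]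
    ring
  have hsupp : ∀ᵐ t ∂W.measure, t ∈ Icc ((k : ℝ) / n) (m / n) := by
    have h1 : W.measure (Ioi ((m : ℝ) / n)) = 0 := by
      rw [W.measure_Ioi htop, hWr _ le_rfl, sub_self, ENNReal.ofReal_zero]
    have h2 : W.measure (Iio ((k : ℝ) / n)) = 0 := by
      rw [W.measure_Iio hbot, ENNReal.ofReal_eq_zero, sub_nonpos]
      refine (leftLim_eq_of_tendsto (tendsto_const_nhds.congr' ?_)).le
      filter_upwards [self_mem_nhdsWithin] with x hx
      exact (hWl x hx).symm
    have h3 : W.measure (Icc ((k : ℝ) / n) (m / n))ᶜ = 0 := by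
      refine measure_mono_null (fun x hx => ?_) (measure_union_null h1 h2)
      by_contra hx'
      simp only [mem_union, mem_Ioi, mem_Iio, not_or, not_lt] at hx'
      exact hx ⟨hx'.2, hx'.1⟩
    exact h3
  have hμ : W.measure (Ioo (0 : ℝ) 1)ᶜ = 0 := by
    refine measure_mono_null (compl_subset_compl.2 fun x hx => ?_) hsupp
    have : (0 : ℝ) < k / n := by positivity
    exact ⟨this.trans_le hx.1, lt_of_le_of_lt hx.2 hm1⟩
  have hWi : ∀ p q, IntervalIntegrable W volume p q := fun p q => W.mono.intervalIntegrable
  have hgi : ∀ p q, IntervalIntegrable (gStair n) volume p q := fun p q =>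
    (gStair_monotone n).intervalIntegrable
  have hk0 : (0 : ℝ) ≤ k / n := by positivity
  have hIl : ∫ x in (0 : ℝ)..(k / n), 2 * lam * (W x - gStair n x) = 1 := by
    rw [intervalIntegral_congr_of_Ioo hk0 (h := fun x => 2 * lam * (c - gStair n x))
      fun x hx => by rw [hWl x hx.2], intervalIntegral.integral_const_mul,
      intervalIntegral.integral_sub (by simp) (hgi _ _), integral_gStair hn,
      intervalIntegral.integral_const, smul_eq_mul, hc]
    field_simp
    ring
  have hIr : ∫ x in (m / n : ℝ)..1, 2 * lam * (W x - gStair n x) = -1 := by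
    have e1 : ∫ x in (0 : ℝ)..1, gStair n x = n * (n + 1) / (2 * n ^ 2) := by
      rw [← integral_gStair hn n, div_self hn'.ne']
    have e2 : ∫ x in (m / n : ℝ)..1, gStair n x
        = n * (n + 1) / (2 * n ^ 2) - m * (m + 1) / (2 * n ^ 2) := by
      rw [← e1, ← integral_gStair hn m, intervalIntegral.integral_interval_sub_left (hgi _ _)
        (hgi _ _)]
    rw [intervalIntegral_congr_of_Ioo hm1.le (h := fun x => 2 * lam * (d - gStair n x))
      fun x hx => by rw [hWr x hx.1.le], intervalIntegral.integral_const_mul,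
      intervalIntegral.integral_sub (by simp) (hgi _ _), e2,
      intervalIntegral.integral_const, smul_eq_mul, hd, hc, hmr]
    field_simp
    ring
  obtain ⟨hZ0, hZ1, hZ2⟩ := primitive_bounds hab
    (fun p q => ((hWi p q).sub (hgi p q)).const_mul (2 * lam))
    (fun x hx => mul_nonneg (by positivity) (by
      rw [hWl x hx]
      linarith [gStair_le_of_lt hn hx]))
    (fun x hx => by rw [hWm x hx, sub_self, mul_zero])
    (fun x hx => mul_nonpos_of_nonneg_of_nonpos (by positivity) (by
      rw [hWr x hx]
      linarith [le_gStair_of_le hn hx])) hIl hIr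
  refine ⟨W, W.measure, c, d, isDerivMeasures_of_eq_add_measureReal hμ hWx,
    fun u μp μn hu => ?_, hWl, hWm, hWr⟩
  refine ROFenergy_le_of_calibration hlam.le (gStair_monotone n).measurable
    (M := max |gStair n 0| |gStair n 1|) (fun x hx => ?_) hμ hWx hZ0 hZ1
    (hsupp.mono hZ2) hu
  exact abs_le_max_abs_abs (gStair_monotone n hx.1.le) (gStair_monotone n hx.2.le)

/-- staircase effect for the ROF model: for `λ > 4`, the unique
minimizers `u_n` of `ROF_{λ,g_n}` on `BV(]0,1[)` coincide with the staircase data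
`g_n` on intervals `[a_n, b_n]` with `a_n → 1/√λ`, `b_n → 1 - 1/√λ`, and are
constant on `[0, a_n)` and `(b_n, 1]`. -/
theorem statement_13 (lam : ℝ) (hlam : 4 < lam)
    (u : ℕ → ℝ → ℝ) (μp μn : ℕ → Measure ℝ)
    (hder : ∀ n, IsDerivMeasures 0 1 (u n) (μp n) (μn n))
    (hmin : ∀ n, ∀ (w : ℝ → ℝ) (ηp ηn : Measure ℝ), IsDerivMeasures 0 1 w ηp ηn →
      ROFenergy 0 1 lam (gStair n) (u n) (μp n) (μn n) ≤
        ROFenergy 0 1 lam (gStair n) w ηp ηn)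
    (huniq : ∀ n, ∀ (w : ℝ → ℝ) (ηp ηn : Measure ℝ), IsDerivMeasures 0 1 w ηp ηn →
      ROFenergy 0 1 lam (gStair n) w ηp ηn =
        ROFenergy 0 1 lam (gStair n) (u n) (μp n) (μn n) →
      ∀ᵐ x ∂(MeasureTheory.volume.restrict (Set.Ioo (0 : ℝ) 1)), w x = u n x) :
    ∃ (N : ℕ) (A B : ℕ → ℝ),
      (∀ n ≥ N, 0 < A n ∧ A n < B n ∧ B n < 1 ∧
        (∀ᵐ x ∂(MeasureTheory.volume.restrict (Set.Icc (A n) (B n))),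
          u n x = gStair n x) ∧
        (∃ c : ℝ, ∀ᵐ x ∂(MeasureTheory.volume.restrict (Set.Ico (0 : ℝ) (A n))),
          u n x = c) ∧
        (∃ c : ℝ, ∀ᵐ x ∂(MeasureTheory.volume.restrict (Set.Ioc (B n) (1 : ℝ))),
          u n x = c)) ∧
      Tendsto A atTop (𝓝 (1 / Real.sqrt lam)) ∧
      Tendsto B atTop (𝓝 (1 - 1 / Real.sqrt lam)) := by
  have hlam0 : 0 < lam := by linarith
  choose K hK0 hK1 hK2 using fun n : ℕ =>
    exists_nat_mul_pred_le_le_mul_succ (s := (n : ℝ) ^ 2 / lam) (by positivity)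
  have hsq : √lam ^ 2 = lam := Real.sq_sqrt hlam0.le
  have hs2 : 2 < √lam := Real.lt_sqrt_of_sq_lt (by linarith)
  have hr : (1 / √lam) ^ 2 = 1 / lam := by rw [div_pow, hsq, one_pow]
  have hr0 : 0 < 1 / √lam := by positivity
  have hA : Tendsto (fun n => (K n : ℝ) / n) atTop (𝓝 (1 / √lam)) := by
    have hinv : Tendsto (fun n : ℕ => 1 / (n : ℝ)) atTop (𝓝 0) := tendsto_one_div_atTop_nhds_zero_nat
    have hlow : Tendsto (fun n : ℕ => 1 / √lam - 1 / (n : ℝ)) atTop (𝓝 (1 / √lam)) := by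
      simpa using tendsto_const_nhds.sub hinv
    have hup : Tendsto (fun n : ℕ => 1 / √lam + 1 / (n : ℝ)) atTop (𝓝 (1 / √lam)) := by
      simpa using tendsto_const_nhds.add hinv
    refine tendsto_of_tendsto_of_tendsto_of_le_of_le' hlow hup ?_ ?_
    all_goals
      filter_upwards [eventually_gt_atTop 0] with n hn
      have hn' : (0 : ℝ) < n := Nat.cast_pos.2 hn
      have hk' : (0 : ℝ) < K n := Nat.cast_pos.2 (hK0 n)
      have e : (n : ℝ) ^ 2 / lam = (n / √lam) ^ 2 := by rw [div_pow, hsq]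
      have hp : 0 < n / √lam := by positivity
      have h1 := hK1 n
      have h2 := hK2 n
      rw [e] at h1 h2
    · have : (n : ℝ) / √lam ≤ K n + 1 := by
        by_contra! h
        nlinarith
      calc 1 / √lam - 1 / n = (n / √lam - 1) / n := by field_simp
        _ ≤ K n / n := by gcongr; linarith
    · have : (K n : ℝ) ≤ n / √lam + 1 := by
        by_contra! h
        nlinarith
      calc (K n : ℝ) / n ≤ (n / √lam + 1) / n := by gcongr
        _ = 1 / √lam + 1 / n := by field_simp
  have hhalf : 1 / √lam < 1 / 2 := one_div_lt_one_div_of_lt two_pos hs2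
  obtain ⟨N, hN⟩ := eventually_atTop.1
    ((hA.eventually_lt_const hhalf).and (eventually_gt_atTop 0))
  refine ⟨N, fun n => K n / n, fun n => 1 - K n / n, fun n hn => ?_, hA, hA.const_sub 1⟩
  obtain ⟨hAn, hn0⟩ := hN n hn
  have hn' : (0 : ℝ) < n := Nat.cast_pos.2 hn0
  have hA0 : (0 : ℝ) < K n / n := div_pos (Nat.cast_pos.2 (hK0 n)) hn'
  have hKn : 2 * K n < n := by
    rw [div_lt_div_iff₀ hn' two_pos] at hAn
    have : (2 * K n : ℝ) < n := by linarith
    exact_mod_cast this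
  obtain ⟨w, μ, c, d, hwd, hwmin, hwl, hwm, hwr⟩ :=
    exists_gStair_minimizer hlam0 (hK0 n) hKn (hK1 n) (hK2 n)
  have hae := huniq n w μ 0 hwd
    (le_antisymm (hwmin _ _ _ (hder n)) (hmin n w μ 0 hwd))
  rw [ae_restrict_iff' measurableSet_Ioo] at hae
  have hne : ∀ p : ℝ, ∀ᵐ x : ℝ, x ≠ p := fun p => by
    simp [ae_iff]
  beta_reduce
  refine ⟨hA0, by linarith, by linarith, ?_, ⟨c, ?_⟩, ⟨d, ?_⟩⟩
  · rw [ae_restrict_iff' measurableSet_Icc]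
    filter_upwards [hae, hne (1 - K n / n)] with x hx hxn hxI
    rw [← hx ⟨by linarith [hxI.1], by linarith [hxI.2]⟩,
      hwm x ⟨hxI.1, lt_of_le_of_ne hxI.2 hxn⟩]
  · rw [ae_restrict_iff' measurableSet_Ico]
    filter_upwards [hae, hne 0] with x hx hxn hxI
    rw [← hx ⟨lt_of_le_of_ne hxI.1 hxn.symm, by linarith [hxI.2]⟩, hwl x hxI.2]
  · rw [ae_restrict_iff' measurableSet_Ioc]
    filter_upwards [hae, hne 1] with x hx hxn hxI
    rw [← hx ⟨by linarith [hxI.1], lt_of_le_of_ne hxI.2 hxn⟩, hwr x hxI.1.le]
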